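/- arXiv:1208.6000 — 2 statements merged into one kernel-verified Lean document; each statement's English description precedes it below -/
import Mathlib

section
/- Let n ≥ 2 and δ ∈ (0,1). For ε ∈ (0,1) set U_ε = B_1 \ closure(B_{1−ε}) ⊂ ℝ^{2n}. Then for every ε ∈ (δ, 1) one has c_δ(U_ε) = π. -/
open Metric Set MeasureTheory Real Filter Topology Bornology
open scoped ContDiff ENNReal

noncomputable section

/-- `ℝ^{2n}` with the Euclidean structure. -/
abbrev R2n (n : ℕ) := EuclideanSpace ℝ (Fin (2 * n))

/-- The standard symplectic form `ω_st = Σ dx_i ∧ dy_i` on `ℝ^{2n}`,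
evaluated on a pair of (tangent) vectors. -/
def sympForm (n : ℕ) (v w : R2n n) : ℝ :=
  ∑ i : Fin n,
    (v ⟨2 * i.1, by have := i.isLt; omega⟩ * w ⟨2 * i.1 + 1, by have := i.isLt; omega⟩ -
      v ⟨2 * i.1 + 1, by have := i.isLt; omega⟩ * w ⟨2 * i.1, by have := i.isLt; omega⟩)

/-- `φ` is a symplectic embedding of the open set `N ⊆ ℝ^{2n}` into `U ⊆ ℝ^{2n}`:
a smooth injective map on `N` with image in `U` whose derivative preserves `ω_st`. -/
def IsSympEmbOn (n : ℕ) (N U : Set (R2n n)) (φ : R2n n → R2n n) : Prop :=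
  IsOpen N ∧ ContDiffOn ℝ ∞ φ N ∧ InjOn φ N ∧ MapsTo φ N U ∧
    ∀ p ∈ N, ∀ v w : R2n n,
      sympForm n (fderiv ℝ φ p v) (fderiv ℝ φ p w) = sympForm n v w

/-- A symplectic embedding of (a neighbourhood of) an arbitrary set `A ⊆ ℝ^{2n}` into `U`. -/
def SympEmbNbhd (n : ℕ) (A U : Set (R2n n)) : Prop :=
  ∃ N φ, A ⊆ N ∧ IsSympEmbOn n N U φ

/-- The spherical capacity `s(U)`. -/
def sphericalCap (n : ℕ) (U : Set (R2n n)) : ℝ≥0∞ :=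
  sSup {c : ℝ≥0∞ | ∃ r : ℝ, 0 < r ∧ c = ENNReal.ofReal (π * r ^ 2) ∧
    SympEmbNbhd n (sphere (0 : R2n n) r) U}

/-- The quadratic form defining the ellipsoid with symplectic half axes `a i`. -/
def ellQ (n : ℕ) (a : Fin n → ℝ) (z : R2n n) : ℝ :=
  ∑ i : Fin n,
    ((z ⟨2 * i.1, by have := i.isLt; omega⟩) ^ 2 +
      (z ⟨2 * i.1 + 1, by have := i.isLt; omega⟩) ^ 2) / (a i) ^ 2

/-- The open ellipsoid `E(a 0, …, a (n-1)) ⊆ ℝ^{2n}`. -/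
def ellipsoid (n : ℕ) (a : Fin n → ℝ) : Set (R2n n) := {z | ellQ n a z < 1}

/-- The boundary `∂E(a 0, …, a (n-1)) ⊆ ℝ^{2n}` of an ellipsoid. -/
def ellipsoidBdry (n : ℕ) (a : Fin n → ℝ) : Set (R2n n) := {z | ellQ n a z = 1}

/-- The ellipsoidal shell `U_ε = (1+ε)E \ closure((1-ε)E)`. -/
def ellShell (n : ℕ) (a : Fin n → ℝ) (ε : ℝ) : Set (R2n n) :=
  ellipsoid n (fun i => (1 + ε) * a i) \ closure (ellipsoid n (fun i => (1 - ε) * a i))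

/-- The `δ`-shell capacity `c_δ(U)`, defined via embeddings of the closed
shells `r A_δ = closure(B_r) \ B_{r(1-δ)}`. -/
def shellCap (n : ℕ) (δ : ℝ) (U : Set (R2n n)) : ℝ≥0∞ :=
  sSup {c : ℝ≥0∞ | ∃ r : ℝ, 0 < r ∧ c = ENNReal.ofReal (π * r ^ 2) ∧
    SympEmbNbhd n (closedBall (0 : R2n n) r \ ball 0 (r * (1 - δ))) U}

/-- The ellipsoidal capacity `e(U)`: the supremum of `π r₁²` over symplectic embeddings of
boundaries of ellipsoids with half axes `r₁ ≤ … ≤ r_n` (here `r₁ = ⨅ i, a i`). -/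
def ellipsoidalCap (n : ℕ) (U : Set (R2n n)) : ℝ≥0∞ :=
  sSup {c : ℝ≥0∞ | ∃ a : Fin n → ℝ, (∀ i, 0 < a i) ∧ Monotone a ∧
    c = ENNReal.ofReal (π * (⨅ i, a i) ^ 2) ∧ SympEmbNbhd n (ellipsoidBdry n a) U}

/-- The Gromov radius `c_B(U)`. -/
def gromovRadius (n : ℕ) (U : Set (R2n n)) : ℝ≥0∞ :=
  sSup {c : ℝ≥0∞ | ∃ r : ℝ, 0 < r ∧ c = ENNReal.ofReal (π * r ^ 2) ∧
    ∃ φ, IsSympEmbOn n (ball (0 : R2n n) r) U φ}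

open scoped RealInnerProductSpace

/-- A function that is `C^k` on an open set and vanishes off a closed subset of it is `C^k`. -/
theorem contDiff_of_eq_zero_off {E F : Type*} [NormedAddCommGroup E] [NormedSpace ℝ E]
    [NormedAddCommGroup F] [NormedSpace ℝ F] {k : WithTop ℕ∞} {f : E → F} {N K : Set E}
    (hN : IsOpen N) (hf : ContDiffOn ℝ k f N) (hK : IsClosed K) (hKN : K ⊆ N)
    (h0 : ∀ x ∉ K, f x = 0) : ContDiff ℝ k f := by
  rw [contDiff_iff_contDiffAt]
  intro x
  by_cases hx : x ∈ N
  · exact hf.contDiffAt (hN.mem_nhds hx)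
  · have : f =ᶠ[𝓝 x] fun _ => (0 : F) := by
      filter_upwards [hK.isOpen_compl.mem_nhds (fun h => hx (hKN h))] with y hy using h0 y hy
    exact contDiffAt_const.congr_of_eventuallyEq this

theorem fderiv_eq_zero_of_eq_zero_off {E F : Type*} [NormedAddCommGroup E] [NormedSpace ℝ E]
    [NormedAddCommGroup F] [NormedSpace ℝ F] {f : E → F} {K : Set E} (hK : IsClosed K)
    (h0 : ∀ x ∉ K, f x = 0) {x : E} (hx : x ∉ K) : fderiv ℝ f x = 0 := by
  have : f =ᶠ[𝓝 x] fun _ => (0 : F) := by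
    filter_upwards [hK.isOpen_compl.mem_nhds hx] with y hy using h0 y hy
  rw [this.fderiv_eq]; simp

/-- A function with vanishing derivative on an open set is constant on preconnected subsets. -/
theorem IsPreconnected.eq_of_fderiv_eq_zero {E F : Type*} [NormedAddCommGroup E] [NormedSpace ℝ E]
    [NormedAddCommGroup F] [NormedSpace ℝ F] {f : E → F} {s C : Set E}
    (hC : IsPreconnected C) (hs : IsOpen s) (hCs : C ⊆ s) (hf : DifferentiableOn ℝ f s)
    (hf' : s.EqOn (fderiv ℝ f) 0) {x y : E} (hx : x ∈ C) (hy : y ∈ C) : f x = f y := by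
  by_contra hne
  obtain ⟨z, _, ⟨_, h1⟩, ⟨_, h2⟩⟩ := hC _ _ (hs.isOpen_inter_preimage_of_fderiv_eq_zero hf hf' {f x})
    (hs.isOpen_inter_preimage_of_fderiv_eq_zero hf hf' {f x}ᶜ)
    (fun z hz => by
      by_cases h : f z = f x
      · exact Or.inl ⟨hCs hz, h⟩
      · exact Or.inr ⟨hCs hz, h⟩)
    ⟨x, hx, hCs hx, rfl⟩ ⟨y, hy, hCs hy, fun h => hne h.symm⟩
  exact h2 h1

theorem isPreconnected_norm_preimage {E : Type*} [NormedAddCommGroup E] [NormedSpace ℝ E]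
    (h : 1 < Module.rank ℝ E) {I : Set ℝ} (hI : I.OrdConnected) (hpos : ∀ t ∈ I, 0 < t) :
    IsPreconnected {x : E | ‖x‖ ∈ I} := by
  have : {x : E | ‖x‖ ∈ I} = (fun q : ℝ × E => q.1 • q.2) '' (I ×ˢ sphere (0 : E) 1) := by
    ext x
    constructor
    · intro hx
      have hx0 := (hpos _ hx).ne'
      exact ⟨(‖x‖, ‖x‖⁻¹ • x), ⟨hx, by simp [norm_smul, hx0]⟩, by simp [smul_smul, hx0]⟩
    · rintro ⟨⟨t, u⟩, ⟨ht, hu⟩, rfl⟩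
      simp only [mem_sphere_iff_norm, sub_zero] at hu ht
      simpa [norm_smul, hu, abs_of_pos (hpos t ht)] using ht
  rw [this]
  exact (hI.isPreconnected.prod (isPreconnected_sphere h 0 1)).image _ (by fun_prop)

section InnerProduct

variable {E : Type*} [NormedAddCommGroup E] [InnerProductSpace ℝ E] [FiniteDimensional ℝ E]

section Divergence

variable [MeasurableSpace E] [BorelSpace E]

/-- The divergence of a compactly supported vector field integrates to zero. -/
theorem integral_trace_fderiv_eq_zero {W : E → E} (hW : ContDiff ℝ 1 W)
    (hc : HasCompactSupport W) :
    ∫ x, LinearMap.trace ℝ E (fderiv ℝ W x : E →ₗ[ℝ] E) = 0 := by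
  let b := stdOrthonormalBasis ℝ E
  have hcont : Continuous (fderiv ℝ W) := hW.continuous_fderiv (by simp)
  have hint : ∀ i, Integrable (fun x => ⟪b i, fderiv ℝ W x (b i)⟫) := fun i => by
    apply Continuous.integrable_of_hasCompactSupport
    · fun_prop
    · apply (hc.fderiv ℝ).mono
      intro x hx h
      simp only [Function.mem_support] at hx
      exact hx (by simp [h])
  have key : ∀ i, ∫ x, ⟪b i, fderiv ℝ W x (b i)⟫ = 0 := fun i => by
    have hg : ContDiff ℝ 1 (fun x => ⟪b i, W x⟫) := contDiff_const.inner ℝ hW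
    have hd : ∀ x, fderiv ℝ (fun x => ⟪b i, W x⟫) x (b i) = ⟪b i, fderiv ℝ W x (b i)⟫ := fun x => by
      rw [fderiv_inner_apply ℝ (by fun_prop) ((hW.differentiable (by simp)) x)]
      simp
    have := integral_mul_fderiv_eq_neg_fderiv_mul_of_integrable (μ := volume) (f := fun _ : E => (1 : ℝ))
      (g := fun x => ⟪b i, W x⟫) (v := b i) (by simp) (by simpa [hd] using hint i)
      (by
        simp only [one_mul]
        apply Continuous.integrable_of_hasCompactSupport
        · exact hg.continuous
        · apply hc.mono
          intro x hx h
          simp only [Function.mem_support] at hx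
          exact hx (by simp [h]))
      (fun x _ => by fun_prop) (fun x _ => (hg.differentiable (by simp)) x)
    simpa [hd] using this
  simp_rw [LinearMap.trace_eq_sum_inner _ b]
  simp only [ContinuousLinearMap.coe_coe]
  rw [integral_finsetSum _ (fun i _ => hint i)]
  simp [key]

end Divergence

theorem trace_eq_zero_of_skew {J : E →L[ℝ] E} (hJ : ∀ v w, ⟪J v, w⟫ = -⟪v, J w⟫) :
    LinearMap.trace ℝ E (J : E →ₗ[ℝ] E) = 0 := by
  rw [LinearMap.trace_eq_sum_inner _ (stdOrthonormalBasis ℝ E)]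
  refine Finset.sum_eq_zero fun i _ => ?_
  have := hJ (stdOrthonormalBasis ℝ E i) (stdOrthonormalBasis ℝ E i)
  rw [real_inner_comm] at this
  simp only [ContinuousLinearMap.coe_coe]
  linarith

theorem trace_skew_comp_symm_eq_zero {J B : E →L[ℝ] E} (hJ : ∀ v w, ⟪J v, w⟫ = -⟪v, J w⟫)
    (hB : ∀ v w, ⟪B v, w⟫ = ⟪B w, v⟫) :
    LinearMap.trace ℝ E (J ∘L B : E →L[ℝ] E) = 0 := by
  have h1 : LinearMap.trace ℝ E (J ∘L B : E →L[ℝ] E) =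
      - LinearMap.trace ℝ E (B ∘L J : E →L[ℝ] E) := by
    rw [LinearMap.trace_eq_sum_inner _ (stdOrthonormalBasis ℝ E),
      LinearMap.trace_eq_sum_inner _ (stdOrthonormalBasis ℝ E), ← Finset.sum_neg_distrib]
    refine Finset.sum_congr rfl fun i _ => ?_
    simp only [ContinuousLinearMap.coe_coe, ContinuousLinearMap.comp_apply]
    rw [real_inner_comm, hJ, hB, real_inner_comm]
  have h2 : LinearMap.trace ℝ E (J ∘L B : E →L[ℝ] E) =
      LinearMap.trace ℝ E (B ∘L J : E →L[ℝ] E) := by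
    exact LinearMap.trace_mul_comm ℝ (J : E →ₗ[ℝ] E) (B : E →ₗ[ℝ] E)
  linarith

theorem trace_smulRight (l : E →L[ℝ] ℝ) (u : E) :
    LinearMap.trace ℝ E (l.smulRight u : E →L[ℝ] E) = l u := by
  simp [LinearMap.trace_smulRight]

omit [FiniteDimensional ℝ E] in
theorem hasFDerivAt_comp_norm_sq {p : ℝ → ℝ} {x : E} (hp : DifferentiableAt ℝ p (‖x‖ ^ 2)) :
    HasFDerivAt (fun x : E => p (‖x‖ ^ 2)) ((deriv p (‖x‖ ^ 2) * 2) • innerSL ℝ x) x := by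
  have h := hp.hasDerivAt.comp_hasFDerivAt x (hasStrictFDerivAt_norm_sq x).hasFDerivAt
  refine h.congr_fderiv ?_
  ext v
  simp
  ring

omit [FiniteDimensional ℝ E] in
theorem inner_skew_self {J : E →L[ℝ] E} (hJ : ∀ v w, ⟪J v, w⟫ = -⟪v, J w⟫) (x : E) :
    ⟪x, J x⟫ = 0 := by
  have := hJ x x
  rw [real_inner_comm] at this
  linarith

/-- The field `⟪b, J x⟫ x - ⟪b, x⟫ J x + ‖x‖² J b` is tangent to spheres, and if `b` has symmetric
derivative, its divergence is `(dim E - 2) ⟪b, J x⟫`. -/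
theorem trace_fderiv_tangential {J : E →L[ℝ] E} (hJ : ∀ v w, ⟪J v, w⟫ = -⟪v, J w⟫)
    {b : E → E} {B : E →L[ℝ] E} {q : E → ℝ} {c : ℝ} {x : E} (hb : HasFDerivAt b B x)
    (hB : ∀ v w, ⟪B v, w⟫ = ⟪B w, v⟫) (hq : HasFDerivAt q (c • innerSL ℝ x) x) :
    LinearMap.trace ℝ E (fderiv ℝ
      (fun x => q x • (⟪b x, J x⟫ • x - ⟪b x, x⟫ • J x + ‖x‖ ^ 2 • J (b x))) x : E →L[ℝ] E) =
      (Module.finrank ℝ E - 2 : ℝ) * (q x * ⟪b x, J x⟫) := by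
  have hJd : HasFDerivAt (fun x => J x) J x := J.hasFDerivAt
  have hid : HasFDerivAt (fun x : E => x) (ContinuousLinearMap.id ℝ E) x := hasFDerivAt_id x
  have hn : HasFDerivAt (fun x : E => ‖x‖ ^ 2) (2 • innerSL ℝ x) x :=
    (hasStrictFDerivAt_norm_sq x).hasFDerivAt
  have hJb : HasFDerivAt (fun x => J (b x)) (J ∘L B) x := J.hasFDerivAt.comp x hb
  have h := hq.fun_smul ((((hb.inner ℝ hJd).fun_smul hid).fun_sub
    ((hb.inner ℝ hid).fun_smul hJd)).fun_add (hn.fun_smul hJb))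
  rw [h.fderiv]
  have hxx := inner_skew_self hJ x
  have hbb := inner_skew_self hJ (b x)
  have e1 := hB x (J x)
  have e2 : ⟪x, J (b x)⟫ = - ⟪b x, J x⟫ := by rw [real_inner_comm, hJ]
  have e3 : ⟪x, b x⟫ = ⟪b x, x⟫ := real_inner_comm _ _
  have e4 : ⟪J x, b x⟫ = ⟪b x, J x⟫ := real_inner_comm _ _
  simp only [ContinuousLinearMap.toLinearMap_add, ContinuousLinearMap.toLinearMap_sub, ContinuousLinearMap.toLinearMap_smul, map_add,
    map_sub, map_smul, trace_smulRight, trace_eq_zero_of_skew hJ,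
    trace_skew_comp_symm_eq_zero hJ hB, ContinuousLinearMap.coe_id, LinearMap.trace_id]
  simp [fderivInnerCLM_apply, hxx, e2]
  rw [← e1]
  ring

variable [MeasurableSpace E] [BorelSpace E]

/-- A closed `1`-form on a neighbourhood of a spherical shell in dimension greater than two has
zero weighted average along the orbits of `x ↦ J x`. -/
theorem integral_closed_form_rotation_eq_zero (hdim : 2 < Module.finrank ℝ E)
    {J : E →L[ℝ] E} (hJ : ∀ v w, ⟪J v, w⟫ = -⟪v, J w⟫)
    {b : E → E} {N K : Set E} (hN : IsOpen N) (hb : ContDiffOn ℝ 1 b N)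
    (hB : ∀ x ∈ N, ∀ v w, ⟪fderiv ℝ b x v, w⟫ = ⟪fderiv ℝ b x w, v⟫)
    (hK : IsCompact K) (hKN : K ⊆ N) {p : ℝ → ℝ} (hp : ContDiff ℝ 1 p)
    (hp0 : ∀ x ∉ K, p (‖x‖ ^ 2) = 0) :
    Integrable (fun x => p (‖x‖ ^ 2) * ⟪b x, J x⟫) ∧ ∫ x, p (‖x‖ ^ 2) * ⟪b x, J x⟫ = 0 := by
  set W : E → E := fun x =>
    p (‖x‖ ^ 2) • (⟪b x, J x⟫ • x - ⟪b x, x⟫ • J x + ‖x‖ ^ 2 • J (b x)) with hW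
  have hW0 : ∀ x ∉ K, W x = 0 := fun x hx => by simp [hW, hp0 x hx]
  have hJc : ContDiff ℝ 1 (fun x => J x) := J.contDiff
  have hnc : ContDiff ℝ 1 (fun x : E => ‖x‖ ^ 2) := contDiff_norm_sq ℝ
  have hWd : ContDiff ℝ 1 W := by
    refine contDiff_of_eq_zero_off hN ?_ hK.isClosed hKN hW0
    refine (hp.comp hnc).contDiffOn.smul ((ContDiffOn.sub ?_ ?_).add ?_)
    · exact (hb.inner ℝ hJc.contDiffOn).smul contDiffOn_id
    · exact (hb.inner ℝ contDiffOn_id).smul hJc.contDiffOn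
    · exact hnc.contDiffOn.smul (J.contDiff.comp_contDiffOn hb)
  have hdiv : ∀ x, LinearMap.trace ℝ E (fderiv ℝ W x : E →L[ℝ] E) =
      (Module.finrank ℝ E - 2 : ℝ) * (p (‖x‖ ^ 2) * ⟪b x, J x⟫) := fun x => by
    by_cases hx : x ∈ N
    · have hq : HasFDerivAt (fun x : E => p (‖x‖ ^ 2))
          ((deriv p (‖x‖ ^ 2) * 2) • innerSL ℝ x) x :=
        hasFDerivAt_comp_norm_sq ((hp.differentiable (by simp)) _)
      exact trace_fderiv_tangential hJ
        ((hb.contDiffAt (hN.mem_nhds hx)).differentiableAt (by simp)).hasFDerivAt (hB x hx) hq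
    · have hxK : x ∉ K := fun h => hx (hKN h)
      rw [fderiv_eq_zero_of_eq_zero_off hK.isClosed hW0 hxK, hp0 x hxK]
      simp
  constructor
  · have hd : ContDiff ℝ 1 (fun x => p (‖x‖ ^ 2) * ⟪b x, J x⟫) :=
      contDiff_of_eq_zero_off hN
        ((hp.comp hnc).contDiffOn.mul (hb.inner ℝ hJc.contDiffOn)) hK.isClosed hKN
        fun x hx => by simp [hp0 x hx]
    exact hd.continuous.integrable_of_hasCompactSupport
      (HasCompactSupport.intro hK fun x hx => by simp [hp0 x hx])
  have h := integral_trace_fderiv_eq_zero hWd (HasCompactSupport.intro hK hW0)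
  simp_rw [hdiv, integral_const_mul] at h
  refine (mul_eq_zero.mp h).resolve_left ?_
  have : (2 : ℝ) < Module.finrank ℝ E := by exact_mod_cast hdim
  linarith

omit [MeasurableSpace E] [BorelSpace E] in
theorem abs_det_eq_one_of_preserves {J T : E →L[ℝ] E} (hJ2 : ∀ v, J (J v) = -v)
    (hT : ∀ v w, ⟪J (T v), T w⟫ = ⟪J v, w⟫) : |T.det| = 1 := by
  have hadj : T.adjoint ∘L J ∘L T = J := by
    ext v
    refine ext_inner_right ℝ fun w => ?_
    simp [ContinuousLinearMap.adjoint_inner_left, hT]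
  have hdetJ : (J : E →ₗ[ℝ] E).det ≠ 0 := fun h0 => by
    have hcomp : (J : E →ₗ[ℝ] E) * (J : E →ₗ[ℝ] E) = (-1 : ℝ) • 1 := by
      ext v
      simp [hJ2]
    have := congrArg LinearMap.det hcomp
    rw [map_mul, h0, LinearMap.det_smul, map_one] at this
    simp at this
    exact pow_ne_zero _ (by norm_num : (-1 : ℝ) ≠ 0) this.symm
  have hTadj : (T.adjoint : E →ₗ[ℝ] E).det = (T : E →ₗ[ℝ] E).det := by
    rw [← LinearMap.det_toMatrix (stdOrthonormalBasis ℝ E).toBasis,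
      ← LinearMap.det_toMatrix (stdOrthonormalBasis ℝ E).toBasis (T : E →ₗ[ℝ] E),
      show (T.adjoint : E →ₗ[ℝ] E) = LinearMap.adjoint (T : E →ₗ[ℝ] E) from rfl,
      LinearMap.toMatrix_adjoint, Matrix.det_conjTranspose]
    rfl
  have h1 : (T.adjoint : E →ₗ[ℝ] E) * ((J : E →ₗ[ℝ] E) * (T : E →ₗ[ℝ] E)) = (J : E →ₗ[ℝ] E) := by
    ext v
    exact congrArg (fun L : E →L[ℝ] E => L v) hadj
  have h2 := congrArg LinearMap.det h1
  rw [map_mul, map_mul, hTadj] at h2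
  have h3 : (T : E →ₗ[ℝ] E).det ^ 2 = 1 := by
    have : ((T : E →ₗ[ℝ] E).det ^ 2 - 1) * (J : E →ₗ[ℝ] E).det = 0 := by linear_combination h2
    linarith [(mul_eq_zero.mp this).resolve_right hdetJ]
  rw [← sq_abs] at h3
  exact (pow_eq_one_iff_of_nonneg (abs_nonneg _) two_ne_zero).mp h3

theorem two_le_infty : (2 : WithTop ℕ∞) ≤ ((⊤ : ℕ∞) : WithTop ℕ∞) :=
  WithTop.coe_le_coe.mpr (le_top : (2 : ℕ∞) ≤ ⊤)

omit [MeasurableSpace E] [BorelSpace E] in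
/-- The difference of the pulled back and the standard Liouville form is a closed `1`-form. -/
theorem exists_closed_liouville_difference {J : E →L[ℝ] E} {φ : E → E} {N : Set E}
    (hN : IsOpen N) (hφ : ContDiffOn ℝ ∞ φ N)
    (hsymp : ∀ x ∈ N, ∀ v w, ⟪J (fderiv ℝ φ x v), fderiv ℝ φ x w⟫ = ⟪J v, w⟫) :
    ∃ b : E → E, ContDiffOn ℝ 1 b N ∧
      (∀ x ∈ N, ∀ v w, ⟪fderiv ℝ b x v, w⟫ = ⟪fderiv ℝ b x w, v⟫) ∧
      ∀ x v, ⟪b x, v⟫ = ⟪J (φ x), fderiv ℝ φ x v⟫ - ⟪J x, v⟫ := by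
  let o := stdOrthonormalBasis ℝ E
  let b : E → E := fun x => ∑ i, ⟪J (φ x), fderiv ℝ φ x (o i)⟫ • o i - J x
  have hb : ∀ x v, ⟪b x, v⟫ = ⟪J (φ x), fderiv ℝ φ x v⟫ - ⟪J x, v⟫ := fun x v => by
    have hv : fderiv ℝ φ x v = ∑ i, ⟪o i, v⟫ • fderiv ℝ φ x (o i) := by
      conv_lhs => rw [← o.sum_repr' v]
      simp
    simp [b, hv, inner_sub_left, sum_inner, inner_sum, inner_smul_left, inner_smul_right, mul_comm]
  have hDφ : ContDiffOn ℝ 1 (fderiv ℝ φ) N := hφ.fderiv_of_isOpen hN (one_add_one_eq_two.trans_le two_le_infty)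
  have hφ1 : ContDiffOn ℝ 1 φ N := hφ.of_le (by simp)
  have hbc : ContDiffOn ℝ 1 b N := by
    refine ContDiffOn.sub (ContDiffOn.sum fun i _ => ?_) J.contDiff.contDiffOn
    exact ((J.contDiff.comp_contDiffOn hφ1).inner ℝ (hDφ.clm_apply contDiffOn_const)).smul
      contDiffOn_const
  refine ⟨b, hbc, fun x hx v w => ?_, hb⟩
  have hbd := ((hbc.contDiffAt (hN.mem_nhds hx)).differentiableAt (by simp)).hasFDerivAt
  have hφd := ((hφ1.contDiffAt (hN.mem_nhds hx)).differentiableAt (by simp)).hasFDerivAt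
  have hDd := ((hDφ.contDiffAt (hN.mem_nhds hx)).differentiableAt (by simp)).hasFDerivAt
  have hsym : IsSymmSndFDerivAt ℝ φ x :=
    (hφ.contDiffAt (hN.mem_nhds hx)).isSymmSndFDerivAt (by simpa using two_le_infty)
  have key : ∀ v w, ⟪fderiv ℝ b x v, w⟫ = ⟪J (φ x), fderiv ℝ (fderiv ℝ φ) x v w⟫ := fun v w => by
    have h1 := hbd.inner ℝ (hasFDerivAt_const w x)
    have h2 := ((J.hasFDerivAt.comp x hφd).inner ℝ (hDd.clm_apply (hasFDerivAt_const w x))).fun_sub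
      (J.hasFDerivAt.inner ℝ (hasFDerivAt_const w x))
    have h3 : (fun x => ⟪b x, w⟫) = fun x => ⟪J (φ x), fderiv ℝ φ x w⟫ - ⟪J x, w⟫ :=
      funext fun x => hb x w
    rw [h3] at h1
    have h4 := congrArg (fun L : E →L[ℝ] ℝ => L v) (h1.unique h2)
    simpa [fderivInnerCLM_apply, hsymp x hx] using h4
  rw [key, key, hsym]

omit [MeasurableSpace E] [BorelSpace E] in
theorem exists_openPartialHomeomorph_of_injOn {φ : E → E} {N : Set E}
    (hN : IsOpen N) (hφ : ContDiffOn ℝ ∞ φ N) (hinj : InjOn φ N)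
    (hdet : ∀ x ∈ N, (fderiv ℝ φ x).det ≠ 0) :
    ∃ e : OpenPartialHomeomorph E E, e.source = N ∧ ⇑e = φ := by
  have hopen : IsOpenMap (N.domRestrict φ) := by
    rw [isOpenMap_iff_nhds_le]
    rintro ⟨x, hx⟩
    have hs : HasStrictFDerivAt φ (fderiv ℝ φ x) x :=
      (hφ.contDiffAt (hN.mem_nhds hx)).hasStrictFDerivAt (by simp)
    have heq := HasStrictFDerivAt.map_nhds_eq_of_equiv
      (f' := (fderiv ℝ φ x).toContinuousLinearEquivOfDetNeZero (hdet x hx)) (by simpa using hs)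
    have : Filter.map (N.domRestrict φ) (𝓝 ⟨x, hx⟩) = Filter.map φ (𝓝 x) := by
      rw [← map_nhds_subtype_coe_eq_nhds hx (hN.mem_nhds hx), Filter.map_map]
      rfl
    rw [this, heq]
    rfl
  exact ⟨OpenPartialHomeomorph.ofContinuousOpenRestrict (hinj.toPartialEquiv φ N)
    hφ.continuousOn hopen hN, rfl, rfl⟩

omit [MeasurableSpace E] [BorelSpace E] in
/-- Transport of a function with differential supported in a compact subset of the domain of an
embedding: the pushed forward differential is exact on the whole space. -/
theorem exists_pushforward_primitive {φ : E → E} {N K : Set E} {c : E → ℝ}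
    (hN : IsOpen N) (hφ : ContDiffOn ℝ ∞ φ N) (hinj : InjOn φ N)
    (hdet : ∀ x ∈ N, (fderiv ℝ φ x).det ≠ 0) (hK : IsCompact K) (hKN : K ⊆ N)
    (hc : ContDiff ℝ ∞ c) (hc0 : ∀ x ∉ K, fderiv ℝ c x = 0) :
    ∃ g : E → ℝ, ContDiff ℝ 1 g ∧ (∀ y ∉ φ '' K, fderiv ℝ g y = 0) ∧
      ∀ x ∈ N, fderiv ℝ g (φ x) ∘L fderiv ℝ φ x = fderiv ℝ c x := by
  obtain ⟨e, rfl, rfl⟩ := exists_openPartialHomeomorph_of_injOn hN hφ hinj hdet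
  have hsymm : ContDiffOn ℝ ∞ e.symm e.target := fun y hy => by
    have hx := e.map_target hy
    have hs := hφ.contDiffAt (hN.mem_nhds hx)
    refine (e.contDiffAt_symm (f₀' := (fderiv ℝ e (e.symm y)).toContinuousLinearEquivOfDetNeZero
      (hdet _ hx)) hy ?_ hs).contDiffWithinAt
    simpa using (hs.differentiableAt (by simp)).hasFDerivAt
  have hu : ContDiffOn ℝ ∞ (fun y => c (e.symm y)) e.target := hc.comp_contDiffOn hsymm
  set u : E → ℝ := fun y => c (e.symm y) with hudef
  let α : E → E →L[ℝ] ℝ := e.target.indicator (fderiv ℝ u)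
  have hchain : ∀ y ∈ e.target, fderiv ℝ u y = fderiv ℝ c (e.symm y) ∘L fderiv ℝ e.symm y :=
    fun y hy => fderiv_comp y ((hc.differentiable (by simp)) _)
      ((hsymm.contDiffAt (e.open_target.mem_nhds hy)).differentiableAt (by simp))
  have hKc : IsClosed (e '' K) := (hK.image_of_continuousOn (hφ.continuousOn.mono hKN)).isClosed
  have hKt : e '' K ⊆ e.target := by
    rintro _ ⟨x, hx, rfl⟩
    exact e.map_source (hKN hx)
  have hα0 : ∀ y ∉ e '' K, α y = 0 := fun y hy => by
    by_cases hyt : y ∈ e.target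
    · simp only [α, indicator_of_mem hyt]
      rw [hchain y hyt, hc0 _ fun h => hy ⟨_, h, e.right_inv hyt⟩]
      simp
    · simp [α, indicator_of_notMem hyt]
  have hαc : ContDiff ℝ 1 α := by
    refine contDiff_of_eq_zero_off e.open_target ?_ hKc hKt hα0
    exact (hu.fderiv_of_isOpen e.open_target (one_add_one_eq_two.trans_le two_le_infty)).congr
      fun y hy => by simp [α, indicator_of_mem hy]
  have hαsym : ∀ y v w, fderiv ℝ α y v w = fderiv ℝ α y w v := fun y v w => by
    by_cases hyt : y ∈ e.target
    · have heq : α =ᶠ[𝓝 y] fderiv ℝ u := by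
        filter_upwards [e.open_target.mem_nhds hyt] with z hz
        simp [α, indicator_of_mem hz]
      rw [heq.fderiv_eq]
      exact (hu.contDiffAt (e.open_target.mem_nhds hyt)).isSymmSndFDerivAt (by simpa using two_le_infty) v w
    · rw [fderiv_eq_zero_of_eq_zero_off hKc hα0 fun h => hyt (hKt h)]
      simp
  obtain ⟨g, hg⟩ := convex_univ.exists_forall_hasFDerivAt_of_fderiv_symmetric isOpen_univ
    (hαc.differentiable (by simp)).differentiableOn (fun a _ => hαsym a)
  have hgα : fderiv ℝ g = α := funext fun y => (hg y (mem_univ y)).fderiv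
  refine ⟨g, contDiff_one_iff_fderiv.mpr
    ⟨fun y => (hg y (mem_univ y)).differentiableAt, hgα ▸ hαc.continuous⟩,
    fun y hy => by rw [hgα, hα0 y hy], fun x hx => ?_⟩
  have hy := e.map_source hx
  have heq : (fun x => u (e x)) =ᶠ[𝓝 x] c := by
    filter_upwards [hN.mem_nhds hx] with z hz
    simp [u, e.left_inv hz]
  rw [← heq.fderiv_eq, hgα]
  simp only [α, indicator_of_mem hy]
  exact (fderiv_comp x ((hu.contDiffAt (e.open_target.mem_nhds hy)).differentiableAt (by simp))
    ((hφ.contDiffAt (hN.mem_nhds hx)).differentiableAt (by simp))).symm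

omit [FiniteDimensional ℝ E] [MeasurableSpace E] [BorelSpace E] in
theorem exists_mem_eq_of_fderiv_eq_zero_off {G : E → ℝ} {K : Set E} (hG : Differentiable ℝ G)
    (hK : IsClosed K) (hne : K.Nonempty) (h0 : ∀ y ∉ K, fderiv ℝ G y = 0) (y : E) :
    ∃ z ∈ K, G z = G y := by
  by_contra! hcon
  have hopen : IsOpen (G ⁻¹' {G y}) := by
    have h := hK.isOpen_compl.isOpen_inter_preimage_of_fderiv_eq_zero hG.differentiableOn
      (fun z hz => h0 z hz) {G y}
    rwa [inter_eq_self_of_subset_right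
      (show G ⁻¹' {G y} ⊆ Kᶜ from fun z hz hzK => hcon z hzK hz)] at h
  have huniv := IsClopen.eq_univ ⟨isClosed_singleton.preimage hG.continuous, hopen⟩ ⟨y, rfl⟩
  obtain ⟨z, hz⟩ := hne
  exact hcon z hz (huniv ▸ mem_univ z : z ∈ G ⁻¹' {G y})

theorem finrank_mul_integral_eq {f : E → ℝ} (hf : ContDiff ℝ 1 f) (hc : HasCompactSupport f) :
    (Module.finrank ℝ E : ℝ) * ∫ x, f x = -∫ x, fderiv ℝ f x x := by
  have hW : ContDiff ℝ 1 (fun x => f x • x) := hf.smul contDiff_id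
  have h := integral_trace_fderiv_eq_zero hW hc.smul_right
  have htr : ∀ x, LinearMap.trace ℝ E (fderiv ℝ (fun x => f x • x) x : E →L[ℝ] E) =
      (Module.finrank ℝ E : ℝ) * f x + fderiv ℝ f x x := fun x => by
    have hd := ((hf.differentiable (by simp)) x).hasFDerivAt.fun_smul (hasFDerivAt_id x)
    simp only [id] at hd
    rw [hd.fderiv]
    simp only [ContinuousLinearMap.toLinearMap_add, ContinuousLinearMap.toLinearMap_smul, map_add,
      map_smul, trace_smulRight, ContinuousLinearMap.coe_id, LinearMap.trace_id]
    simp [mul_comm]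
  simp_rw [htr] at h
  rw [integral_add, integral_const_mul] at h
  · linarith
  · exact (hf.continuous.integrable_of_hasCompactSupport hc).const_mul _
  · refine Continuous.integrable_of_hasCompactSupport
      ((hf.continuous_fderiv (by simp)).clm_apply continuous_id) ((hc.fderiv ℝ).mono ?_)
    intro x hx h
    simp only [Function.mem_support] at hx
    exact hx (by simp [h])

/-- A symplectic embedding into the unit ball of a neighbourhood of a spherical shell in dimension
greater than two: the inner radius of the shell is at most one. -/
theorem inner_radius_le_one_of_symplectic_embedding (hdim : 2 < Module.finrank ℝ E)
    {J : E →L[ℝ] E} (hJ : ∀ v w, ⟪J v, w⟫ = -⟪v, J w⟫) (hJ2 : ∀ v, J (J v) = -v)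
    {φ : E → E} {N : Set E} (hN : IsOpen N) (hφ : ContDiffOn ℝ ∞ φ N) (hinj : InjOn φ N)
    (hmaps : MapsTo φ N (ball 0 1))
    (hsymp : ∀ x ∈ N, ∀ v w, ⟪J (fderiv ℝ φ x v), fderiv ℝ φ x w⟫ = ⟪J v, w⟫)
    {a b : ℝ} (ha : 0 < a) (hab : a < b) (hsub : {x : E | ‖x‖ ∈ Icc a b} ⊆ N) : a ≤ 1 := by
  have hrank : 1 < Module.rank ℝ E := by
    rw [← Module.finrank_eq_rank]
    exact_mod_cast (by omega : 1 < Module.finrank ℝ E)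
  have : Nontrivial E := Module.nontrivial_of_finrank_pos (R := ℝ) (by omega)
  have hdet1 : ∀ x ∈ N, |(fderiv ℝ φ x).det| = 1 := fun x hx =>
    abs_det_eq_one_of_preserves hJ2 (hsymp x hx)
  have hdet : ∀ x ∈ N, (fderiv ℝ φ x).det ≠ 0 := fun x hx h => by
    have := hdet1 x hx
    simp [h] at this
  set K : Set E := {x : E | ‖x‖ ∈ Icc a b} with hKdef
  have hK : IsCompact K := by
    refine (isCompact_closedBall (0 : E) b).of_isClosed_subset
      (isClosed_Icc.preimage continuous_norm) fun x hx => ?_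
    simpa using hx.2
  have hKpre : IsPreconnected K :=
    isPreconnected_norm_preimage hrank ordConnected_Icc fun t ht => ha.trans_le ht.1
  -- the radial cutoff function
  let χ : ℝ → ℝ := fun s => smoothTransition ((b ^ 2 - s) / (b ^ 2 - a ^ 2))
  have hpos : 0 < b ^ 2 - a ^ 2 := by nlinarith
  have hχ : ContDiff ℝ ∞ χ := Real.smoothTransition.contDiff.comp (by fun_prop)
  have hχ1 : ∀ s ≤ a ^ 2, χ s = 1 := fun s hs =>
    Real.smoothTransition.one_of_one_le ((one_le_div hpos).mpr (by linarith))
  have hχ0 : ∀ s, b ^ 2 ≤ s → χ s = 0 := fun s hs =>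
    Real.smoothTransition.zero_of_nonpos (div_nonpos_of_nonpos_of_nonneg (by linarith) hpos.le)
  have hp : ContDiff ℝ 1 (deriv χ) :=
    ContDiff.deriv' (hχ.of_le (one_add_one_eq_two.trans_le two_le_infty))
  have hp0 : ∀ x ∉ K, deriv χ (‖x‖ ^ 2) = 0 := fun x hx => by
    rcases lt_or_ge ‖x‖ a with h | h
    · have heq : χ =ᶠ[𝓝 (‖x‖ ^ 2)] fun _ => 1 := by
        filter_upwards [Iio_mem_nhds (show ‖x‖ ^ 2 < a ^ 2 by gcongr)] with s hs
        exact hχ1 s (le_of_lt hs)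
      rw [heq.deriv_eq, deriv_const]
    · have h' : b < ‖x‖ := not_le.mp fun h' => hx ⟨h, h'⟩
      have heq : χ =ᶠ[𝓝 (‖x‖ ^ 2)] fun _ => 0 := by
        filter_upwards [Ioi_mem_nhds (show b ^ 2 < ‖x‖ ^ 2 by gcongr; linarith)] with s hs
        exact hχ0 s (le_of_lt hs)
      rw [heq.deriv_eq, deriv_const]
  let c : E → ℝ := fun x => χ (‖x‖ ^ 2)
  have hc : ContDiff ℝ ∞ c := hχ.comp (contDiff_norm_sq ℝ)
  have hDc : ∀ x v, fderiv ℝ c x v = 2 * deriv χ (‖x‖ ^ 2) * ⟪x, v⟫ := fun x v => by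
    rw [(hasFDerivAt_comp_norm_sq (hχ.differentiable (by simp) _)).fderiv]
    simp only [_root_.smul_apply, innerSL_apply_apply, smul_eq_mul]
    ring
  have hc0 : ∀ x ∉ K, fderiv ℝ c x = 0 := fun x hx => by
    ext v
    simp [hDc, hp0 x hx]
  have hcsupp : HasCompactSupport c :=
    HasCompactSupport.intro (isCompact_closedBall (0 : E) b) fun x hx => by
      have hx' : b < ‖x‖ := by simpa using hx
      exact hχ0 _ (by gcongr; linarith)
  -- the transported function, normalised to vanish at infinity
  obtain ⟨g, hg, hg0, hgφ⟩ := exists_pushforward_primitive hN hφ hinj hdet hK hsub hc hc0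
  have hφK : φ '' K ⊆ ball 0 1 := by
    rintro _ ⟨x, hx, rfl⟩
    exact hmaps (hsub hx)
  have hK'c : IsClosed (φ '' K) :=
    (hK.image_of_continuousOn (hφ.continuousOn.mono hsub)).isClosed
  obtain ⟨z, hz⟩ : ∃ z : E, ‖z‖ = 1 := exists_norm_eq E zero_le_one
  let G : E → ℝ := fun y => g y - g z
  have hG : ContDiff ℝ 1 G := hg.sub contDiff_const
  have hGd : Differentiable ℝ G := hG.differentiable (by simp)
  have hDG : fderiv ℝ G = fderiv ℝ g := funext fun y => fderiv_sub_const _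
  have hG0 : ∀ y, 1 ≤ ‖y‖ → G y = 0 := fun y hy => by
    have hext : IsPreconnected {y : E | ‖y‖ ∈ Ici (1 : ℝ)} :=
      isPreconnected_norm_preimage hrank ordConnected_Ici fun t ht => one_pos.trans_le ht
    have : g y = g z := hext.eq_of_fderiv_eq_zero hK'c.isOpen_compl
      (fun w (hw : 1 ≤ ‖w‖) hwK => absurd (hφK hwK) (by simpa using hw))
      (hg.differentiable (by simp)).differentiableOn (fun w hw => hg0 w hw) hy hz.ge
    simp [G, this]
  have hGsupp : HasCompactSupport G :=
    HasCompactSupport.intro (isCompact_closedBall (0 : E) 1) fun y hy => by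
      have hy' : 1 < ‖y‖ := by simpa using hy
      exact hG0 y hy'.le
  obtain ⟨x₀, hx₀⟩ : ∃ x : E, ‖x‖ = a := exists_norm_eq E ha.le
  have hx₀K : x₀ ∈ K := ⟨hx₀.ge, hx₀.le.trans hab.le⟩
  have hφd : ∀ x ∈ N, DifferentiableAt ℝ φ x := fun x hx =>
    (hφ.contDiffAt (hN.mem_nhds hx)).differentiableAt (by simp)
  obtain ⟨d, hd⟩ : ∃ d, ∀ x ∈ K, G (φ x) = c x + d := by
    have hder : ∀ x ∈ N, HasFDerivAt (fun x => G (φ x) - c x) (0 : E →L[ℝ] ℝ) x := fun x hx => by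
      have h1 := ((hGd (φ x)).hasFDerivAt.comp x (hφd x hx).hasFDerivAt).fun_sub
        ((hc.differentiable (by simp)) x).hasFDerivAt
      rw [hDG, hgφ x hx, sub_self] at h1
      exact h1
    refine ⟨G (φ x₀) - c x₀, fun x hx => ?_⟩
    have := hKpre.eq_of_fderiv_eq_zero hN hsub
      (fun x hx => (hder x hx).differentiableAt.differentiableWithinAt)
      (fun x hx => (hder x hx).fderiv) hx hx₀K
    linarith
  have hval : ∀ y, ∃ x ∈ K, G y = c x + d := fun y => by
    obtain ⟨_, ⟨x, hx, rfl⟩, h⟩ := exists_mem_eq_of_fderiv_eq_zero_off hGd hK'c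
      ⟨φ x₀, x₀, hx₀K, rfl⟩ (fun y hy => by rw [hDG, hg0 y hy]) y
    exact ⟨x, hx, by rw [← h, hd x hx]⟩
  have hd0 : d ≤ 0 := by
    obtain ⟨x, _, h⟩ := hval z
    rw [hG0 z hz.ge] at h
    have : 0 ≤ c x := Real.smoothTransition.nonneg _
    linarith
  have hG1 : ∀ y, G y ≤ 1 := fun y => by
    obtain ⟨x, _, h⟩ := hval y
    have : c x ≤ 1 := Real.smoothTransition.le_one _
    linarith
  -- both functions have the same integral
  obtain ⟨β, hβ, hβsym, hβφ⟩ := exists_closed_liouville_difference hN hφ hsymp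
  obtain ⟨hrotI, hrot⟩ :=
    integral_closed_form_rotation_eq_zero hdim hJ hN hβ hβsym hK hsub hp hp0
  have hpt : ∀ x ∈ N, fderiv ℝ G (φ x) (φ x) =
      fderiv ℝ c x x + 2 * (deriv χ (‖x‖ ^ 2) * ⟪β x, J x⟫) := fun x hx => by
    obtain ⟨v, hv⟩ : ∃ v, fderiv ℝ φ x v = φ x :=
      ⟨((fderiv ℝ φ x).toContinuousLinearEquivOfDetNeZero (hdet x hx)).symm (φ x),
        ((fderiv ℝ φ x).toContinuousLinearEquivOfDetNeZero (hdet x hx)).apply_symm_apply (φ x)⟩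
    have h1 : fderiv ℝ G (φ x) (φ x) = fderiv ℝ c x v := by
      rw [← hgφ x hx, hDG, ContinuousLinearMap.comp_apply, hv]
    have h2 : ⟪J (φ x), fderiv ℝ φ x (J x)⟫ = ⟪x, v⟫ := by
      rw [← hv, hsymp x hx, hJ, hJ2, inner_neg_right, neg_neg, real_inner_comm]
    have h3 : ⟪J x, J x⟫ = ⟪x, x⟫ := by rw [hJ, hJ2, inner_neg_right, neg_neg]
    rw [h1, hDc, hDc, hβφ, h2, h3]
    ring
  have hcI : Integrable (fun x => fderiv ℝ c x x) := by
    refine Continuous.integrable_of_hasCompactSupport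
      ((hc.continuous_fderiv (by simp)).clm_apply continuous_id)
      (HasCompactSupport.intro hK fun x hx => by simp [hc0 x hx])
  have hcov : ∫ y, fderiv ℝ G y y = ∫ x, fderiv ℝ c x x := by
    calc ∫ y, fderiv ℝ G y y = ∫ y in φ '' N, fderiv ℝ G y y :=
          (setIntegral_eq_integral_of_forall_compl_eq_zero fun y hy => by
            rw [hDG, hg0 y fun h => hy (image_mono hsub h)]
            rfl).symm
      _ = ∫ x in N, |(fderiv ℝ φ x).det| • fderiv ℝ G (φ x) (φ x) :=
          integral_image_eq_integral_abs_det_fderiv_smul volume hN.measurableSet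
            (fun x hx => (hφd x hx).hasFDerivAt.hasFDerivWithinAt) hinj _
      _ = ∫ x in N, (fderiv ℝ c x x + 2 * (deriv χ (‖x‖ ^ 2) * ⟪β x, J x⟫)) :=
          setIntegral_congr_fun hN.measurableSet fun x hx => by
            simp only [hdet1 x hx, one_smul, hpt x hx]
      _ = ∫ x, (fderiv ℝ c x x + 2 * (deriv χ (‖x‖ ^ 2) * ⟪β x, J x⟫)) :=
          setIntegral_eq_integral_of_forall_compl_eq_zero fun x hx => by
            have hxK : x ∉ K := fun h => hx (hsub h)
            simp [hc0 x hxK, hp0 x hxK]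
      _ = ∫ x, fderiv ℝ c x x := by
          rw [integral_add hcI (hrotI.const_mul 2), integral_const_mul, hrot]
          simp
  have hint : ∫ y, G y = ∫ x, c x := by
    have h1 := finrank_mul_integral_eq hG hGsupp
    have h2 := finrank_mul_integral_eq (hc.of_le (by simp)) hcsupp
    rw [hcov, ← h2] at h1
    exact mul_left_cancel₀ (by positivity) h1
  -- comparison of volumes
  have hupper : ∫ y, G y ≤ volume.real (ball (0 : E) 1) := by
    rw [← integral_indicator_one measurableSet_ball]
    refine integral_mono (hG.continuous.integrable_of_hasCompactSupport hGsupp)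
      ((integrable_indicator_iff measurableSet_ball).mpr
        (integrableOn_const measure_ball_lt_top.ne)) fun y => ?_
    by_cases hy : y ∈ ball (0 : E) 1
    · simpa [indicator_of_mem hy] using hG1 y
    · simpa [indicator_of_notMem hy] using (hG0 y (by simpa using hy)).le
  have hlower : volume.real (ball (0 : E) a) ≤ ∫ x, c x := by
    rw [← integral_indicator_one measurableSet_ball]
    refine integral_mono ((integrable_indicator_iff measurableSet_ball).mpr
        (integrableOn_const measure_ball_lt_top.ne))
        (hc.continuous.integrable_of_hasCompactSupport hcsupp) fun x => ?_
    by_cases hx : x ∈ ball (0 : E) a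
    · have hx' : ‖x‖ < a := by simpa using hx
      have : c x = 1 := hχ1 _ (by gcongr)
      simp [indicator_of_mem hx, this]
    · simpa [indicator_of_notMem hx] using (Real.smoothTransition.nonneg _ : 0 ≤ c x)
  have hscale : volume.real (ball (0 : E) a) =
      a ^ Module.finrank ℝ E * volume.real (ball (0 : E) 1) := by
    rw [measureReal_def, Measure.addHaar_ball_of_pos volume 0 ha, ENNReal.toReal_mul,
      ENNReal.toReal_ofReal (by positivity), measureReal_def]
  have hV : 0 < volume.real (ball (0 : E) 1) :=
    ENNReal.toReal_pos (measure_ball_pos volume 0 one_pos).ne' measure_ball_lt_top.ne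
  have hle : a ^ Module.finrank ℝ E * volume.real (ball (0 : E) 1) ≤
      1 * volume.real (ball (0 : E) 1) := by linarith
  exact (pow_le_one_iff_of_nonneg ha.le (by omega)).mp (le_of_mul_le_mul_right hle hV)

end InnerProduct

theorem Fin.sum_two_mul {n : ℕ} (f : Fin (2 * n) → ℝ) :
    ∑ j, f j = ∑ i : Fin n, (f ⟨2 * i.1, by have := i.isLt; omega⟩ +
      f ⟨2 * i.1 + 1, by have := i.isLt; omega⟩) := by
  rw [← (finProdFinEquiv.trans (finCongr (mul_comm n 2))).sum_comp, Fintype.sum_prod_type]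
  refine Finset.sum_congr rfl fun i _ => ?_
  rw [Fin.sum_univ_two]
  congr 2 <;> · ext; simp [finProdFinEquiv]; try omega

/-- The standard complex structure on `ℝ^{2n}`, for which `ω_st(v, w) = ⟪J v, w⟫`. -/
def stdJ (n : ℕ) : R2n n →L[ℝ] R2n n :=
  ((EuclideanSpace.equiv (Fin (2 * n)) ℝ).symm : (Fin (2 * n) → ℝ) →L[ℝ] R2n n).comp
    (ContinuousLinearMap.pi fun j =>
      if j.1 % 2 = 0 then -EuclideanSpace.proj ⟨j.1 / 2 * 2 + 1, by have := j.isLt; omega⟩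
      else EuclideanSpace.proj ⟨j.1 - 1, by have := j.isLt; omega⟩)

theorem stdJ_apply_even (n : ℕ) (v : R2n n) (i : Fin n) :
    stdJ n v ⟨2 * i.1, by have := i.isLt; omega⟩ =
      -v ⟨2 * i.1 + 1, by have := i.isLt; omega⟩ := by
  simp [stdJ, mul_comm]

theorem stdJ_apply_odd (n : ℕ) (v : R2n n) (i : Fin n) :
    stdJ n v ⟨2 * i.1 + 1, by have := i.isLt; omega⟩ =
      v ⟨2 * i.1, by have := i.isLt; omega⟩ := by
  simp [stdJ, Nat.add_mod]

theorem inner_stdJ (n : ℕ) (v w : R2n n) : ⟪stdJ n v, w⟫ = sympForm n v w := by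
  rw [PiLp.inner_apply, Fin.sum_two_mul, sympForm]
  refine Finset.sum_congr rfl fun i _ => ?_
  rw [stdJ_apply_even, stdJ_apply_odd]
  simp
  ring

theorem sympForm_swap (n : ℕ) (v w : R2n n) : sympForm n v w = -sympForm n w v := by
  rw [sympForm, sympForm, ← Finset.sum_neg_distrib]
  refine Finset.sum_congr rfl fun i _ => ?_
  ring

theorem stdJ_skew (n : ℕ) (v w : R2n n) : ⟪stdJ n v, w⟫ = -⟪v, stdJ n w⟫ := by
  rw [real_inner_comm (stdJ n w) v, inner_stdJ, inner_stdJ, sympForm_swap]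

theorem stdJ_stdJ (n : ℕ) (v : R2n n) : stdJ n (stdJ n v) = -v := by
  ext j
  obtain ⟨i, hi | hi⟩ : ∃ i : Fin n, j = ⟨2 * i.1, by have := i.isLt; omega⟩ ∨
      j = ⟨2 * i.1 + 1, by have := i.isLt; omega⟩ := by
    refine ⟨⟨j.1 / 2, by have := j.isLt; omega⟩, ?_⟩
    simp only [Fin.ext_iff]
    omega
  · rw [hi, stdJ_apply_even, stdJ_apply_odd]
    rfl
  · rw [hi, stdJ_apply_odd, stdJ_apply_even]
    rfl

/-- A closed spherical shell symplectically embedded in the unit ball has outer radius at most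
one. -/
theorem radius_le_one_of_sympEmbNbhd {n : ℕ} (hn : 2 ≤ n) {δ r : ℝ} (hδ : 0 < δ) (hr : 0 < r)
    {U : Set (R2n n)} (hU : U ⊆ ball 0 1)
    (h : SympEmbNbhd n (closedBall (0 : R2n n) r \ ball 0 (r * (1 - δ))) U) : r ≤ 1 := by
  obtain ⟨N, φ, hAN, hN, hφ, hinj, hmaps, hsymp⟩ := h
  by_contra! hr1
  obtain ⟨a, ha, har⟩ : ∃ a, max 1 (r * (1 - δ)) < a ∧ a < r :=
    exists_between (max_lt hr1 (by nlinarith))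
  have ha1 : 1 < a := (le_max_left _ _).trans_lt ha
  have ha2 : r * (1 - δ) < a := (le_max_right _ _).trans_lt ha
  refine absurd (inner_radius_le_one_of_symplectic_embedding (by simp; omega) (stdJ_skew n)
    (stdJ_stdJ n) hN hφ hinj (fun x hx => hU (hmaps hx)) (fun x hx v w => ?_)
    (by linarith : 0 < a) har fun x hx => hAN ⟨?_, ?_⟩) ha1.not_ge
  · rw [inner_stdJ, inner_stdJ, hsymp x hx]
  · simpa using hx.2
  · have := hx.1
    simp only [mem_ball_zero_iff, not_lt]
    linarith

theorem sympEmbNbhd_of_subset {n : ℕ} {A U : Set (R2n n)} (hU : IsOpen U) (hA : A ⊆ U) :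
    SympEmbNbhd n A U :=
  ⟨U, id, hA, hU, contDiffOn_id, injOn_id U, mapsTo_id U, fun p _ v w => by simp⟩

/-- For `ε ∈ (δ, 1)` one has `c_δ(U_ε) = π`. -/
theorem shell_capacity_eq_pi
    (n : ℕ) (hn : 2 ≤ n) (δ : ℝ) (hδ : δ ∈ Ioo (0 : ℝ) 1)
    (ε : ℝ) (hε : ε ∈ Ioo δ 1) :
    shellCap n δ (ball (0 : R2n n) 1 \ closedBall 0 (1 - ε)) = ENNReal.ofReal π := by
  obtain ⟨hδ0, hδ1⟩ := hδ
  obtain ⟨hδε, hε1⟩ := hε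
  refine le_antisymm (sSup_le ?_) ?_
  · rintro _ ⟨r, hr, rfl, h⟩
    have hr1 := radius_le_one_of_sympEmbNbhd hn hδ0 hr sdiff_subset h
    apply ENNReal.ofReal_le_ofReal
    have : r ^ 2 ≤ 1 := pow_le_one₀ hr.le hr1
    nlinarith [pi_pos]
  · have hmem : ∀ r : ℝ, 0 < r → 1 - ε < r * (1 - δ) → r < 1 →
        ENNReal.ofReal (π * r ^ 2) ≤
          shellCap n δ (ball (0 : R2n n) 1 \ closedBall 0 (1 - ε)) := by
      refine fun r hr h1 h2 => le_sSup ⟨r, hr, rfl, sympEmbNbhd_of_subset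
        (isOpen_ball.sdiff isClosed_closedBall) fun x hx => ⟨?_, ?_⟩⟩
      · have : ‖x‖ ≤ r := by simpa using hx.1
        simpa using this.trans_lt h2
      · have : r * (1 - δ) ≤ ‖x‖ := by simpa using hx.2
        simpa using h1.trans_le this
    have hlim : Tendsto (fun r : ℝ => ENNReal.ofReal (π * r ^ 2)) (𝓝[<] 1)
        (𝓝 (ENNReal.ofReal π)) := by
      have hcont : Continuous fun r : ℝ => ENNReal.ofReal (π * r ^ 2) :=
        ENNReal.continuous_ofReal.comp (by fun_prop)
      simpa using (hcont.tendsto 1).mono_left nhdsWithin_le_nhds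
    refine le_of_tendsto hlim ?_
    have hq : max 0 ((1 - ε) / (1 - δ)) < 1 :=
      max_lt one_pos ((div_lt_one (by linarith)).mpr (by linarith))
    filter_upwards [Ioo_mem_nhdsLT hq] with r hr
    exact hmem r ((le_max_left _ _).trans_lt hr.1)
      ((div_lt_iff₀ (by linarith)).mp ((le_max_right _ _).trans_lt hr.1)) hr.2
end
end

section
/- Let 0 < ε < 1 and consider the open annulus U = B_{1+ε} \ closure(B_{1−ε}) in ℝ². Then for every r > 0 there exists a symplectic (area-preserving) embedding of an open neighborhood of the circle of radius r into U. Consequently, the 2-dimensional analogue of the spherical capacity, s(U) = sup{πr² : r > 0 and there exists a symplectic embedding of an open neighborhood of the circle of radius r into U}, satisfies s(U) = ∞; in particular s does not define a normalized symplectic capacity in dimension 2. -/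
open Metric Set MeasureTheory Real Filter Topology Bornology
open scoped ContDiff ENNReal

noncomputable section

/-- The radial map `z ↦ √(1 + c / |z|²) z`, which shifts `|z|²` by `c` and fixes angles. -/
def radialShift (c : ℝ) (z : R2n 1) : R2n 1 := √(1 + c / ‖z‖ ^ 2) • z

lemma norm_radialShift_sq {c : ℝ} {z : R2n 1} (hz : 0 < ‖z‖ ^ 2) (hc : 0 < ‖z‖ ^ 2 + c) :
    ‖radialShift c z‖ ^ 2 = ‖z‖ ^ 2 + c := by
  have h : 0 ≤ 1 + c / ‖z‖ ^ 2 := by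
    rw [one_add_div hz.ne']
    positivity
  rw [radialShift, norm_smul, mul_pow, Real.norm_eq_abs, sq_abs, Real.sq_sqrt h, one_add_div hz.ne',
    div_mul_cancel₀ _ hz.ne']

lemma hasFDerivAt_radialShift {c : ℝ} {z : R2n 1} (hz : 0 < ‖z‖ ^ 2)
    (hc : 0 < 1 + c / ‖z‖ ^ 2) :
    HasFDerivAt (radialShift c)
      (√(1 + c / ‖z‖ ^ 2) • ContinuousLinearMap.id ℝ (R2n 1) +
        (((-c / (‖z‖ ^ 2) ^ 2) / (2 * √(1 + c / ‖z‖ ^ 2))) •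
          (2 • innerSL ℝ z)).smulRight z) z := by
  have hg : HasDerivAt (fun s : ℝ => √(1 + c / s))
      ((-c / (‖z‖ ^ 2) ^ 2) / (2 * √(1 + c / ‖z‖ ^ 2))) (‖z‖ ^ 2) := by
    refine HasDerivAt.sqrt ?_ hc.ne'
    have := ((hasDerivAt_inv hz.ne').const_mul c).const_add 1
    simpa [div_eq_mul_inv] using this
  exact (hg.comp_hasFDerivAt z (hasStrictFDerivAt_norm_sq z).hasFDerivAt).smul (hasFDerivAt_id z)

lemma sympForm_one (v w : R2n 1) : sympForm 1 v w = v 0 * w 1 - v 1 * w 0 := by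
  simp [sympForm]

lemma sympForm_fderiv_radialShift {c : ℝ} {z : R2n 1} (hz : 0 < ‖z‖ ^ 2)
    (hc : 0 < ‖z‖ ^ 2 + c) (v w : R2n 1) :
    sympForm 1 (fderiv ℝ (radialShift c) z v) (fderiv ℝ (radialShift c) z w) =
      sympForm 1 v w := by
  have hc' : 0 < 1 + c / ‖z‖ ^ 2 := by
    rw [one_add_div hz.ne']
    positivity
  rw [(hasFDerivAt_radialShift hz hc').fderiv]
  have hg := Real.sq_sqrt hc'.le
  have hg0 := Real.sqrt_pos.2 hc'
  have hs : ‖z‖ ^ 2 = z 0 ^ 2 + z 1 ^ 2 := by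
    simp [EuclideanSpace.norm_sq_eq, Fin.sum_univ_two]
  have hi (u : R2n 1) : inner ℝ z u = z 0 * u 0 + z 1 * u 1 := by
    simp [PiLp.inner_apply, Fin.sum_univ_two, mul_comm]
  set g := √(1 + c / ‖z‖ ^ 2)
  generalize hk : (-c / (‖z‖ ^ 2) ^ 2) / (2 * g) = k
  have hgk : g ^ 2 + 2 * g * k * ‖z‖ ^ 2 = 1 := by
    rw [← hk, hg]
    field_simp
    ring
  rw [hs] at hgk
  simp only [sympForm_one, add_apply, smul_apply,
    ContinuousLinearMap.smulRight_apply, innerSL_apply_apply, hi, PiLp.add_apply,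
    PiLp.smul_apply, smul_eq_mul, nsmul_eq_mul, ContinuousLinearMap.id_apply]
  push_cast
  linear_combination (v 0 * w 1 - v 1 * w 0) * hgk

lemma sympEmbNbhd_sphere_annulus {ε : ℝ} (hε0 : 0 < ε) (hε1 : ε < 1) {r : ℝ} (hr : 0 < r) :
    SympEmbNbhd 1 (sphere (0 : R2n 1) r) (ball (0 : R2n 1) (1 + ε) \ closedBall 0 (1 - ε)) := by
  set c := 1 - r ^ 2 with hc
  let N : Set (R2n 1) := {z | 0 < ‖z‖ ^ 2 ∧ (1 - ε) ^ 2 < ‖z‖ ^ 2 + c ∧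
    ‖z‖ ^ 2 + c < (1 + ε) ^ 2}
  have hpos {z : R2n 1} (hz : z ∈ N) : 0 < ‖z‖ ^ 2 + c := (sq_nonneg _).trans_lt hz.2.1
  have hpos' {z : R2n 1} (hz : z ∈ N) : 0 < 1 + c / ‖z‖ ^ 2 := by
    rw [one_add_div hz.1.ne']
    exact div_pos (hpos hz) hz.1
  refine ⟨N, radialShift c, ?_, ?_, ?_, ?_, ?_, ?_⟩
  · intro z hz
    rw [mem_sphere_zero_iff_norm] at hz
    refine ⟨?_, ?_, ?_⟩ <;> rw [hz] <;> nlinarith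
  · have hn : Continuous fun z : R2n 1 => ‖z‖ ^ 2 := by fun_prop
    exact (isOpen_lt continuous_const hn).inter
      ((isOpen_lt continuous_const (hn.add continuous_const)).inter
        (isOpen_lt (hn.add continuous_const) continuous_const))
  · intro z hz
    have hn : ContDiffAt ℝ ∞ (fun z : R2n 1 => ‖z‖ ^ 2) z := (contDiff_norm_sq ℝ).contDiffAt
    exact (((contDiffAt_const.add (contDiffAt_const.div hn hz.1.ne')).sqrt
      (hpos' hz).ne').smul contDiffAt_id).contDiffWithinAt
  · intro z hz w hw h
    have hn : ‖z‖ ^ 2 = ‖w‖ ^ 2 := by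
      have := congrArg (fun u => ‖u‖ ^ 2) h
      simpa only [norm_radialShift_sq hz.1 (hpos hz), norm_radialShift_sq hw.1 (hpos hw),
        add_left_inj] using this
    rw [radialShift, radialShift, hn] at h
    exact smul_right_injective _ (Real.sqrt_pos.2 (hpos' hw)).ne' h
  · intro z hz
    have hn := norm_radialShift_sq hz.1 (hpos hz)
    rw [Set.mem_sdiff, mem_ball_zero_iff, mem_closedBall_zero_iff, not_le]
    exact ⟨lt_of_pow_lt_pow_left₀ 2 (by linarith) (hn ▸ hz.2.2),
      lt_of_pow_lt_pow_left₀ 2 (norm_nonneg _) (hn ▸ hz.2.1)⟩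
  · exact fun z hz => sympForm_fderiv_radialShift hz.1 (hpos hz)

/-- In dimension `2` (`n = 1`), every circle of radius `r > 0` admits a symplectic
(area-preserving) embedding of a neighbourhood into the annulus
`U = B_(1+ε) \ closure(B_(1-ε))`; consequently `s(U) = ∞`, so the spherical capacity is
not a normalized symplectic capacity in dimension `2`. -/
theorem spherical_capacity_infinite_in_dim_two
    (ε : ℝ) (hε0 : 0 < ε) (hε1 : ε < 1) :
    (∀ r : ℝ, 0 < r → SympEmbNbhd 1 (sphere (0 : R2n 1) r)
        (ball (0 : R2n 1) (1 + ε) \ closedBall 0 (1 - ε))) ∧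
      sphericalCap 1 (ball (0 : R2n 1) (1 + ε) \ closedBall 0 (1 - ε)) = ⊤ := by
  have h := fun (r : ℝ) (hr : 0 < r) => sympEmbNbhd_sphere_annulus hε0 hε1 hr
  refine ⟨h, ENNReal.eq_top_of_forall_nnreal_le fun M => ?_⟩
  have hM : (M : ℝ) ≤ π * (M + 1 : ℝ) ^ 2 := by
    nlinarith [Real.pi_gt_three, M.coe_nonneg, sq_nonneg (M : ℝ),
      mul_nonneg (sub_nonneg.2 Real.pi_gt_three.le) (sq_nonneg ((M : ℝ) + 1))]
  calc (M : ℝ≥0∞) = ENNReal.ofReal M := (ENNReal.ofReal_coe_nnreal).symm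
    _ ≤ ENNReal.ofReal (π * (M + 1 : ℝ) ^ 2) := ENNReal.ofReal_le_ofReal hM
    _ ≤ sphericalCap 1 _ := le_sSup ⟨M + 1, by positivity, rfl, h _ (by positivity)⟩
end
end
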